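/- arXiv:2212.06274 — 2 statements merged into one kernel-verified Lean document; each statement's English description precedes it below -/
import Mathlib

section
/- Let λ_1, λ_2, …, λ_n ∈ k and let t := λ_1 t_1 + λ_2 t_2 + ⋯ + λ_n t_n ∈ k[S_n]. Then the product over all lacunar subsets I of [n−1] of the elements (t − (λ_1 m_{I,1} + λ_2 m_{I,2} + ⋯ + λ_n m_{I,n})·1) is 0 in k[S_n]. (The factors lie in the commutative subalgebra k[t], so the product is well-defined.) -/
noncomputable section

namespace OneSidedCycleShuffles

/-- `sw n i` is the simple transposition `s_i ∈ S_n` (1-indexed: it swaps the values `i` and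
`i+1` of `[n] = {1,…,n}`, realized on the carrier `Fin n` via the identification
`x ∈ [n] ↔ ⟨x-1⟩ : Fin n`); it is the junk value `1` unless `i ∈ [n-1]`. -/
def sw (n i : ℕ) : Equiv.Perm (Fin n) :=
  if h : 1 ≤ i ∧ i < n then Equiv.swap ⟨i - 1, by omega⟩ ⟨i, h.2⟩ else 1

/-- `cyc n l j` is the cycle `cyc_{l,l+1,…,j} ∈ S_n` (sending `l,…,j-1,j` to `l+1,…,j,l`),
written as the product `s_l s_{l+1} ⋯ s_{j-1}` of simple transpositions. -/
def cyc (n l j : ℕ) : Equiv.Perm (Fin n) :=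
  ((List.range' l (j - l)).map (sw n)).prod

/-- The somewhere-to-below shuffle `t_ℓ = cyc_ℓ + cyc_{ℓ,ℓ+1} + ⋯ + cyc_{ℓ,ℓ+1,…,n} ∈ k[S_n]`. -/
def t (n : ℕ) (k : Type*) [CommRing k] (l : ℕ) : MonoidAlgebra k (Equiv.Perm (Fin n)) :=
  ∑ j ∈ Finset.Icc l n, MonoidAlgebra.of k (Equiv.Perm (Fin n)) (cyc n l j)

/-- `m_{I,ℓ}` : (the smallest element of the enclosure `{0} ∪ I ∪ {n+1}` that is `≥ ℓ`) `- ℓ`. -/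
def mIdx (n : ℕ) (I : Finset ℕ) (l : ℕ) : ℕ :=
  sInf {x : ℕ | (x = 0 ∨ x ∈ I ∨ x = n + 1) ∧ l ≤ x} - l

/-- The non-shadow `I' = [n-1] \ (I ∪ (I-1))`. -/
def nonShadow (n : ℕ) (I : Finset ℕ) : Finset ℕ :=
  Finset.Icc 1 (n - 1) \ (I ∪ I.image (fun i => i - 1))

/-- A set of integers is lacunar if it contains no two consecutive integers. -/
def Lacunar (I : Finset ℕ) : Prop := ∀ i ∈ I, i + 1 ∉ I

instance : DecidablePred Lacunar := fun I =>
  decidable_of_iff (∀ i ∈ I, i + 1 ∉ I) Iff.rfl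

/-- The invariant space `F(I) = {q ∈ k[S_n] : q s_i = q for all i ∈ I'}`. -/
def F (n : ℕ) (k : Type*) [CommRing k] (I : Finset ℕ) :
    Submodule k (MonoidAlgebra k (Equiv.Perm (Fin n))) where
  carrier := {q | ∀ i ∈ nonShadow n I, q * MonoidAlgebra.of k (Equiv.Perm (Fin n)) (sw n i) = q}
  add_mem' := by
    intro a b ha hb i hi
    rw [add_mul, ha i hi, hb i hi]
  zero_mem' := by
    intro i hi
    rw [zero_mul]
  smul_mem' := by
    intro c a ha i hi
    rw [smul_mul_assoc, ha i hi]

/-- `F(<c) = ∑_{J ⊆ [n], sum J < c} F(J)`. -/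
def Flt (n : ℕ) (k : Type*) [CommRing k] (c : ℕ) :
    Submodule k (MonoidAlgebra k (Equiv.Perm (Fin n))) :=
  ∑ J ∈ (Finset.Icc 1 n).powerset.filter (fun J => J.sum id < c), F n k J

/-- `F_i = F(Q_1) + ⋯ + F(Q_i)` for an enumeration `Q` of the lacunar subsets of `[n-1]`. -/
def Fi (n : ℕ) (k : Type*) [CommRing k] (Q : ℕ → Finset ℕ) (i : ℕ) :
    Submodule k (MonoidAlgebra k (Equiv.Perm (Fin n))) :=
  ∑ j ∈ Finset.Icc 1 i, F n k (Q j)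

/-- The (1-indexed) value `w(i) ∈ [n]` of a permutation `w ∈ S_n` at `i ∈ [n]`
(junk value `0` if out of range). -/
def pval (n : ℕ) (w : Equiv.Perm (Fin n)) (i : ℕ) : ℕ :=
  if h : i - 1 < n then (w ⟨i - 1, h⟩).val + 1 else 0

/-- The descent set `Des w = {i ∈ [n-1] : w(i) > w(i+1)}`. -/
def Des (n : ℕ) (w : Equiv.Perm (Fin n)) : Finset ℕ :=
  (Finset.Icc 1 (n - 1)).filter fun i => pval n w (i + 1) < pval n w i

/-- `G(T)` : the subgroup of `S_n` generated by the simple transpositions `s_i`, `i ∈ T`. -/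
def G (n : ℕ) (T : Finset ℕ) : Subgroup (Equiv.Perm (Fin n)) :=
  Subgroup.closure ((T.image (sw n) : Finset (Equiv.Perm (Fin n))) : Set (Equiv.Perm (Fin n)))

open scoped Classical in
/-- `a_w = ∑_{σ ∈ G(Des w)} wσ ∈ k[S_n]`. -/
def aw (n : ℕ) (k : Type*) [CommRing k] (w : Equiv.Perm (Fin n)) :
    MonoidAlgebra k (Equiv.Perm (Fin n)) :=
  ∑ σ ∈ Finset.univ.filter (fun σ => σ ∈ G n (Des n w)),
    MonoidAlgebra.of k (Equiv.Perm (Fin n)) (w * σ)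

/-- The Q-index of `w` : the smallest `i ∈ [f_{n+1}]` with `Q_i' ⊆ Des w`. -/
def Qind (n : ℕ) (Q : ℕ → Finset ℕ) (w : Equiv.Perm (Fin n)) : ℕ :=
  sInf {i : ℕ | 1 ≤ i ∧ i ≤ Nat.fib (n + 1) ∧ nonShadow n (Q i) ⊆ Des n w}

/-- The set of inversions of `u ∈ S_n` : pairs `(i,j) ∈ [n] × [n]` with `i < j`, `u(i) > u(j)`. -/
def InvSet (n : ℕ) (u : Equiv.Perm (Fin n)) : Finset (ℕ × ℕ) :=
  (Finset.Icc 1 n ×ˢ Finset.Icc 1 n).filter fun p => p.1 < p.2 ∧ pval n u p.2 < pval n u p.1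

/-- The lexicographic order on `S_n` : `u < v` iff at the smallest `i ∈ [n]` where they
differ, `u(i) < v(i)`. -/
def lexLT (n : ℕ) (u v : Equiv.Perm (Fin n)) : Prop :=
  ∃ i ∈ Finset.Icc 1 n, pval n u i < pval n v i ∧
    ∀ j ∈ Finset.Icc 1 n, j < i → pval n u j = pval n v j

/-- `Z(I) = {q ∈ k[S_n] : q s_i = q for all i ∈ I}`. -/
def Z (n : ℕ) (k : Type*) [CommRing k] (I : Finset ℕ) :
    Submodule k (MonoidAlgebra k (Equiv.Perm (Fin n))) where
  carrier := {q | ∀ i ∈ I, q * MonoidAlgebra.of k (Equiv.Perm (Fin n)) (sw n i) = q}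
  add_mem' := by
    intro a b ha hb i hi
    rw [add_mul, ha i hi, hb i hi]
  zero_mem' := by
    intro i hi
    rw [zero_mul]
  smul_mem' := by
    intro c a ha i hi
    rw [smul_mul_assoc, ha i hi]

/-- `R(x)` : right multiplication by `x`, as a `k`-module endomorphism of `k[S_n]`. -/
def Rmul (n : ℕ) (k : Type*) [CommRing k] (x : MonoidAlgebra k (Equiv.Perm (Fin n))) :
    Module.End k (MonoidAlgebra k (Equiv.Perm (Fin n))) :=
  LinearMap.mulRight k x


section Permutations

variable {n : ℕ}

lemma sw_eq_swap {i : ℕ} (h1 : 1 ≤ i) (h2 : i < n) :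
    sw n i = Equiv.swap ⟨i - 1, by omega⟩ ⟨i, h2⟩ := by
  rw [sw, dif_pos ⟨h1, h2⟩]

lemma sw_mul_self (i : ℕ) : sw n i * sw n i = 1 := by
  unfold sw
  split_ifs <;> simp

lemma sw_comm {i j : ℕ} (h : i + 1 < j) : sw n i * sw n j = sw n j * sw n i := by
  unfold sw
  split_ifs with hi hj <;> try simp
  apply Equiv.Perm.Disjoint.commute
  intro x
  by_cases hx : (x : ℕ) = i - 1 ∨ (x : ℕ) = i
  · right
    apply Equiv.swap_apply_of_ne_of_ne <;> simp [Fin.ext_iff] <;> omega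
  · left
    apply Equiv.swap_apply_of_ne_of_ne <;> simp [Fin.ext_iff] <;> omega

lemma swap_braid {α : Type*} [DecidableEq α] {a b c : α} (hab : a ≠ b) (hac : a ≠ c)
    (hbc : b ≠ c) :
    Equiv.swap a b * Equiv.swap b c * Equiv.swap a b =
      Equiv.swap b c * Equiv.swap a b * Equiv.swap b c := by
  rw [Equiv.swap_mul_swap_mul_swap hab hac, Equiv.swap_comm a b, Equiv.swap_comm b c,
    Equiv.swap_mul_swap_mul_swap hbc.symm hac.symm, Equiv.swap_comm]

lemma sw_braid {i : ℕ} (h1 : 1 ≤ i) (h2 : i + 1 < n) :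
    sw n i * sw n (i + 1) * sw n i = sw n (i + 1) * sw n i * sw n (i + 1) := by
  rw [sw_eq_swap h1 (by omega), sw_eq_swap (by omega) h2]
  simp only [Nat.add_sub_cancel]
  exact swap_braid (by simp [Fin.ext_iff]; omega) (by simp [Fin.ext_iff])
    (by simp [Fin.ext_iff])

lemma cyc_self (l : ℕ) : cyc n l l = 1 := by simp [cyc]

lemma cyc_succ {l j : ℕ} (h : l ≤ j) : cyc n l (j + 1) = cyc n l j * sw n j := by
  rw [cyc, cyc, show j + 1 - l = (j - l) + 1 by omega, List.range'_concat]
  simp [show l + (j - l) = j by omega]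

lemma cyc_succ_mul_sw {l j : ℕ} (h : l ≤ j) : cyc n l (j + 1) * sw n j = cyc n l j := by
  rw [cyc_succ h, mul_assoc, sw_mul_self, mul_one]

lemma cyc_mul_cyc {l r j : ℕ} (h1 : l ≤ r) (h2 : r ≤ j) :
    cyc n l r * cyc n r j = cyc n l j := by
  induction j, h2 using Nat.le_induction with
  | base => rw [cyc_self, mul_one]
  | succ j hj ih => rw [cyc_succ hj, cyc_succ (h1.trans hj), ← mul_assoc, ih]

lemma cyc_mul_sw_of_lt {l j i : ℕ} (h : l ≤ j) (hi : i + 1 < l) :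
    cyc n l j * sw n i = sw n i * cyc n l j := by
  induction j, h using Nat.le_induction with
  | base => simp [cyc_self]
  | succ j hj ih =>
    rw [cyc_succ hj, mul_assoc, ← sw_comm (by omega), ← mul_assoc, ih, mul_assoc]

lemma cyc_mul_sw_of_gt {l j i : ℕ} (h : l ≤ j) (hi : j < i) :
    cyc n l j * sw n i = sw n i * cyc n l j := by
  induction j, h using Nat.le_induction with
  | base => simp [cyc_self]
  | succ j hj ih =>
    rw [cyc_succ hj, mul_assoc, sw_comm (by omega), ← mul_assoc, ih (by omega), mul_assoc]

lemma cyc_mul_sw_of_mem {l j i : ℕ} (hl : 1 ≤ l) (hi : l ≤ i) (hij : i + 2 ≤ j) (hj : j ≤ n) :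
    cyc n l j * sw n i = sw n (i + 1) * cyc n l j := by
  induction j, hij using Nat.le_induction with
  | base =>
    rw [cyc_succ (by omega), cyc_succ hi, mul_assoc, mul_assoc, ← mul_assoc (sw n i),
      sw_braid (by omega) (by omega), ← mul_assoc, ← mul_assoc,
      cyc_mul_sw_of_gt hi (by omega)]
    simp only [mul_assoc]
  | succ j hj' ih =>
    rw [cyc_succ (by omega), mul_assoc, ← sw_comm (by omega), ← mul_assoc, ih (by omega),
      mul_assoc]

end Permutations

section Invariants

variable {n : ℕ} {k : Type*} [CommRing k]

local notation "ι" => MonoidAlgebra.of k (Equiv.Perm (Fin n))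

lemma mul_cyc_of_forall_mul_sw {q : MonoidAlgebra k (Equiv.Perm (Fin n))} {l j : ℕ} (h : l ≤ j)
    (hq : ∀ i, l ≤ i → i < j → q * ι (sw n i) = q) : q * ι (cyc n l j) = q := by
  induction j, h using Nat.le_induction with
  | base => rw [cyc_self, map_one, mul_one]
  | succ j hj ih =>
    rw [cyc_succ hj, map_mul, ← mul_assoc, ih fun i h1 h2 => hq i h1 (by omega),
      hq j hj (by omega)]

lemma mul_sum_cyc_mul_sw_of_mem {q : MonoidAlgebra k (Equiv.Perm (Fin n))} {p r i : ℕ}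
    (hp : 1 ≤ p) (hr : r ≤ n + 1) (hq : ∀ i, p < i → i + 2 ≤ r → q * ι (sw n i) = q)
    (hpi : p ≤ i) (hir : i + 2 ≤ r) :
    (∑ j ∈ Finset.Ico p r, q * ι (cyc n p j)) * ι (sw n i) =
      ∑ j ∈ Finset.Ico p r, q * ι (cyc n p j) := by
  rw [Finset.sum_mul]
  refine Finset.sum_equiv (Equiv.swap i (i + 1)) (fun j => ?_) (fun j hj => ?_)
  · rw [Equiv.swap_apply_def]
    split_ifs <;> simp only [Finset.mem_Ico] <;> omega
  · rw [Finset.mem_Ico] at hj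
    rw [mul_assoc, ← map_mul, Equiv.swap_apply_def]
    split_ifs with h1 h2
    · rw [h1, cyc_succ hpi]
    · rw [h2, cyc_succ_mul_sw hpi]
    · rcases Nat.lt_or_ge j i with h | h
      · rw [cyc_mul_sw_of_gt hj.1 h, map_mul, ← mul_assoc, hq i (by omega) hir]
      · rw [cyc_mul_sw_of_mem hp hpi (by omega) (by omega), map_mul, ← mul_assoc,
          hq (i + 1) (by omega) (by omega)]

lemma mul_sum_cyc_mul_sw_of_notMem {q : MonoidAlgebra k (Equiv.Perm (Fin n))} {p r i : ℕ}
    (hi : i + 1 < p ∨ r ≤ i) (hq : q * ι (sw n i) = q) :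
    (∑ j ∈ Finset.Ico p r, q * ι (cyc n p j)) * ι (sw n i) =
      ∑ j ∈ Finset.Ico p r, q * ι (cyc n p j) := by
  rw [Finset.sum_mul]
  refine Finset.sum_congr rfl fun j hj => ?_
  rw [Finset.mem_Ico] at hj
  have h : cyc n p j * sw n i = sw n i * cyc n p j := by
    rcases hi with hi | hi
    · exact cyc_mul_sw_of_lt hj.1 hi
    · exact cyc_mul_sw_of_gt hj.1 (by omega)
  rw [mul_assoc, ← map_mul, h, map_mul, ← mul_assoc, hq]

lemma mul_t_eq_sum_add {q : MonoidAlgebra k (Equiv.Perm (Fin n))} {p r : ℕ}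
    (hpr : p ≤ r) (hr : r ≤ n + 1) :
    q * t n k p = ∑ j ∈ Finset.Ico p r, q * ι (cyc n p j) + q * ι (cyc n p r) * t n k r := by
  have hI : ∀ a, Finset.Icc a n = Finset.Ico a (n + 1) := fun a => by
    ext; simp only [Finset.mem_Icc, Finset.mem_Ico]; omega
  rw [t, t, hI, hI, ← Finset.sum_Ico_consecutive _ hpr hr, mul_add, Finset.mul_sum,
    Finset.mul_sum, Finset.mul_sum]
  refine congrArg _ (Finset.sum_congr rfl fun j hj => ?_)
  rw [Finset.mem_Ico] at hj
  rw [mul_assoc, ← map_mul, cyc_mul_cyc hpr hj.1]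

lemma t_succ_self : t n k (n + 1) = 0 := by simp [t]

/-- Decrease the element `p` of `I` by one. -/
def lowerAt (I : Finset ℕ) (p : ℕ) : Finset ℕ := insert (p - 1) (I.erase p)

lemma sum_lowerAt_lt {I : Finset ℕ} {p : ℕ} (hp : p ∈ I) (hp1 : 1 ≤ p) :
    (lowerAt I p).sum id < I.sum id := by
  have h1 : (lowerAt I p).sum id ≤ (p - 1) + (I.erase p).sum id := by
    unfold lowerAt
    by_cases h : p - 1 ∈ I.erase p
    · rw [Finset.insert_eq_of_mem h]; omega
    · rw [Finset.sum_insert h]; rfl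
  have h2 := Finset.add_sum_erase I id hp
  simp only [id] at h1 h2 ⊢
  omega

lemma mem_nonShadow {I : Finset ℕ} {i : ℕ} :
    i ∈ nonShadow n I ↔ (1 ≤ i ∧ i < n) ∧ i ∉ I ∧ i + 1 ∉ I := by
  simp only [nonShadow, Finset.mem_sdiff, Finset.mem_Icc, Finset.mem_union, Finset.mem_image,
    not_or, not_exists, not_and]
  constructor
  · rintro ⟨h, h1, h2⟩
    exact ⟨by omega, h1, fun h3 => h2 _ h3 (by omega)⟩
  · rintro ⟨h, h1, h2⟩
    exact ⟨by omega, h1, fun x hx hxi => h2 (by rwa [show i + 1 = x by omega])⟩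

lemma mem_nonShadow_lowerAt {I : Finset ℕ} {p i : ℕ} (h : i ∈ nonShadow n (lowerAt I p)) :
    (1 ≤ i ∧ i < n) ∧ (i ∈ I → i = p) ∧ (i + 1 ∈ I → i + 1 = p) ∧ i ≠ p - 1 ∧ i + 1 ≠ p - 1 := by
  rw [mem_nonShadow] at h
  simp only [lowerAt, Finset.mem_insert, Finset.mem_erase] at h
  tauto

lemma F_mono {I J : Finset ℕ} (h : nonShadow n J ⊆ nonShadow n I) : F n k I ≤ F n k J :=
  fun _ hq i hi => hq i (h hi)

lemma F_le_F_lowerAt {J : Finset ℕ} {j : ℕ} (h1 : 1 ≤ j) (h : n ≤ j ∨ j + 1 ∈ J) :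
    F n k J ≤ F n k (lowerAt J j) := by
  refine F_mono fun i hi => ?_
  have := mem_nonShadow_lowerAt hi
  rw [mem_nonShadow]
  refine ⟨this.1, fun hiJ => ?_, fun hiJ => ?_⟩
  · have hij := this.2.1 hiJ
    subst hij
    have := this.2.2.1 (h.resolve_left (by omega))
    omega
  · have := this.2.2.1 hiJ
    omega

/-- Elements that are invariant under the non-shadow of `I`, except possibly at `p - 2`, are sent
by `t_p` (for `p ∈ I`) into every submodule that contains all `F(K)` with `sum K < sum I`. -/
lemma mul_t_mem {I : Finset ℕ} {N : Submodule k (MonoidAlgebra k (Equiv.Perm (Fin n)))}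
    (hN : ∀ K : Finset ℕ, K.sum id < I.sum id → F n k K ≤ N) (hI : ∀ i ∈ I, i ≤ n)
    (p : ℕ) (hp : p ∈ I) (hp1 : 1 ≤ p) (q : MonoidAlgebra k (Equiv.Perm (Fin n)))
    (hq : ∀ i ∈ nonShadow n I, i + 2 ≠ p → q * ι (sw n i) = q) :
    q * t n k p ∈ N := by
  induction hd : n - p using Nat.strong_induction_on generalizing I p q with
  | _ d ih =>
  have hpn := hI p hp
  obtain ⟨r, hpr, hrn, hgap, hr⟩ : ∃ r, p < r ∧ r ≤ n + 1 ∧ (∀ i, p < i → i < r → i ∉ I) ∧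
      (r ∈ I ∨ r = n + 1) := by
    have hex : ∃ r, p < r ∧ (r ∈ I ∨ r = n + 1) := ⟨n + 1, by omega, Or.inr rfl⟩
    classical
    refine ⟨Nat.find hex, (Nat.find_spec hex).1, Nat.find_min' hex ⟨by omega, Or.inr rfl⟩,
      fun i h1 h2 h3 => Nat.find_min hex h2 ⟨h1, Or.inl h3⟩, (Nat.find_spec hex).2⟩
  rw [mul_t_eq_sum_add hpr.le hrn]
  refine N.add_mem (hN (lowerAt I p) (sum_lowerAt_lt hp hp1) fun i hi => ?_) ?_
  · have hi' := mem_nonShadow_lowerAt hi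
    by_cases hmid : p ≤ i ∧ i + 2 ≤ r
    · refine mul_sum_cyc_mul_sw_of_mem hp1 hrn (fun x h1 h2 => hq x ?_ (by omega)) hmid.1 hmid.2
      exact mem_nonShadow.2 ⟨by omega, hgap x h1 (by omega), hgap (x + 1) (by omega) (by omega)⟩
    · have hir : i + 1 ≠ r := by
        rintro rfl
        rcases hr with hr | hr
        · have := hi'.2.2.1 hr
          omega
        · omega
      refine mul_sum_cyc_mul_sw_of_notMem (by omega) (hq i ?_ (by omega))
      refine mem_nonShadow.2 ⟨hi'.1, fun h => ?_, fun h => ?_⟩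
      · have := hi'.2.1 h
        omega
      · have := hi'.2.2.1 h
        omega
  · rcases hr with hr | rfl
    · have hrn' := hI r hr
      have hrK : r ∈ lowerAt I p :=
        Finset.mem_insert_of_mem (Finset.mem_erase.2 ⟨by omega, hr⟩)
      refine ih (n - r) (by omega) (fun K hK => hN K (hK.trans (sum_lowerAt_lt hp hp1)))
        (fun i hi => ?_) r hrK (by omega) _ (fun i hi hir => ?_) rfl
      · rcases Finset.mem_insert.1 hi with rfl | hi
        · omega
        · exact hI i (Finset.mem_of_mem_erase hi)
      have hi' := mem_nonShadow_lowerAt hi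
      have hne : i ≠ r ∧ i + 1 ≠ r := by
        constructor <;> rintro rfl
        · have := hi'.2.1 hr
          omega
        · have := hi'.2.2.1 hr
          omega
      have hiI : i ≠ p → i ∈ nonShadow n I := fun h => by
        refine mem_nonShadow.2 ⟨hi'.1, fun h' => h (hi'.2.1 h'), fun h' => ?_⟩
        have := hi'.2.2.1 h'
        omega
      rw [mul_assoc, ← map_mul]
      by_cases h1 : i < p
      · rw [cyc_mul_sw_of_lt hpr.le (by omega), map_mul, ← mul_assoc,
          hq i (hiI (by omega)) (by omega)]
      · by_cases h2 : i < r
        · rw [cyc_mul_sw_of_mem hp1 (by omega) (by omega) (by omega), map_mul, ← mul_assoc,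
            hq (i + 1) (mem_nonShadow.2 ⟨by omega, hgap _ (by omega) (by omega),
              hgap _ (by omega) (by omega)⟩) (by omega)]
        · rw [cyc_mul_sw_of_gt hpr.le (by omega), map_mul, ← mul_assoc,
            hq i (hiI (by omega)) (by omega)]
    · rw [t_succ_self, mul_zero]
      exact N.zero_mem

lemma mIdx_eq {I : Finset ℕ} {l p : ℕ} (hlp : l ≤ p) (hl : 1 ≤ l)
    (hp : p ∈ I ∨ p = n + 1) (hpn : p ≤ n + 1) (hgap : ∀ i, l ≤ i → i < p → i ∉ I) :
    mIdx n I l = p - l := by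
  have : IsLeast {x : ℕ | (x = 0 ∨ x ∈ I ∨ x = n + 1) ∧ l ≤ x} p := by
    refine ⟨⟨Or.inr hp, hlp⟩, ?_⟩
    rintro x ⟨rfl | hx | rfl, hlx⟩
    · omega
    · by_contra h
      exact hgap x hlx (by omega) hx
    · exact hpn
  rw [mIdx, this.csInf_eq]

lemma mul_t_sub_mem {I : Finset ℕ} {N : Submodule k (MonoidAlgebra k (Equiv.Perm (Fin n)))}
    (hN : ∀ K : Finset ℕ, K.sum id < I.sum id → F n k K ≤ N) (hI : ∀ i ∈ I, i ≤ n)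
    {q : MonoidAlgebra k (Equiv.Perm (Fin n))} (hq : q ∈ F n k I) {l : ℕ} (hl : 1 ≤ l)
    (hln : l ≤ n) : q * t n k l - (mIdx n I l : k) • q ∈ N := by
  obtain ⟨p, hlp, hpn, hgap, hp⟩ : ∃ p, l ≤ p ∧ p ≤ n + 1 ∧ (∀ i, l ≤ i → i < p → i ∉ I) ∧
      (p ∈ I ∨ p = n + 1) := by
    have hex : ∃ p, l ≤ p ∧ (p ∈ I ∨ p = n + 1) := ⟨n + 1, by omega, Or.inr rfl⟩
    classical
    refine ⟨Nat.find hex, (Nat.find_spec hex).1, Nat.find_min' hex ⟨by omega, Or.inr rfl⟩,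
      fun i h1 h2 h3 => Nat.find_min hex h2 ⟨h1, Or.inl h3⟩, (Nat.find_spec hex).2⟩
  have hinv : ∀ i, l ≤ i → i + 2 ≤ p → q * ι (sw n i) = q := fun i h1 h2 =>
    hq i (mem_nonShadow.2 ⟨by omega, hgap i h1 (by omega), hgap (i + 1) (by omega) (by omega)⟩)
  have hsum : ∑ j ∈ Finset.Ico l p, q * ι (cyc n l j) = ((p - l : ℕ) : k) • q := by
    rw [Finset.sum_congr rfl (g := fun _ => q)]
    · simp [Nat.cast_smul_eq_nsmul]
    · intro j hj
      rw [Finset.mem_Ico] at hj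
      exact mul_cyc_of_forall_mul_sw hj.1 fun i h1 h2 => hinv i h1 (by omega)
  rw [mIdx_eq hlp hl hp hpn hgap, mul_t_eq_sum_add hlp hpn, hsum, add_sub_cancel_left]
  rcases hp with hp | rfl
  · refine mul_t_mem hN hI p hp (by omega) _ fun i hi hip => ?_
    rcases hlp.eq_or_lt with rfl | hlp
    · rw [cyc_self, map_one, mul_one, hq i hi]
    · obtain ⟨r, rfl⟩ : ∃ r, p = r + 1 := ⟨p - 1, by omega⟩
      have hi' := mem_nonShadow.1 hi
      have hne : i ≠ r ∧ i ≠ r + 1 := by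
        constructor <;> rintro rfl <;> tauto
      have hcomm : sw n r * sw n i = sw n i * sw n r := by
        rcases Nat.lt_or_ge i r with h | h
        · exact (sw_comm (by omega)).symm
        · exact sw_comm (by omega)
      rw [cyc_succ (by omega), map_mul, ← mul_assoc,
        mul_cyc_of_forall_mul_sw (by omega) fun i h1 h2 => hinv i h1 (by omega), mul_assoc,
        ← map_mul, hcomm, map_mul, ← mul_assoc, hq i hi]
  · rw [t_succ_self, mul_zero]
    exact N.zero_mem

lemma mul_sum_smul_t_sub_mem {I : Finset ℕ}
    {N : Submodule k (MonoidAlgebra k (Equiv.Perm (Fin n)))}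
    (hN : ∀ K : Finset ℕ, K.sum id < I.sum id → F n k K ≤ N) (hI : ∀ i ∈ I, i ≤ n)
    {q : MonoidAlgebra k (Equiv.Perm (Fin n))} (hq : q ∈ F n k I) (lam : ℕ → k) :
    q * ((∑ l ∈ Finset.Icc 1 n, lam l • t n k l) -
      algebraMap k (MonoidAlgebra k (Equiv.Perm (Fin n)))
        (∑ l ∈ Finset.Icc 1 n, lam l * (mIdx n I l : k))) ∈ N := by
  have : q * ((∑ l ∈ Finset.Icc 1 n, lam l • t n k l) -
      algebraMap k (MonoidAlgebra k (Equiv.Perm (Fin n)))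
        (∑ l ∈ Finset.Icc 1 n, lam l * (mIdx n I l : k))) =
      ∑ l ∈ Finset.Icc 1 n, lam l • (q * t n k l - (mIdx n I l : k) • q) := by
    rw [mul_sub, ← Algebra.commutes, ← Algebra.smul_def, Finset.mul_sum, Finset.sum_smul,
      ← Finset.sum_sub_distrib]
    refine Finset.sum_congr rfl fun l _ => ?_
    rw [mul_smul_comm, smul_sub, smul_smul]
  rw [this]
  refine N.sum_mem fun l hl => N.smul_mem _ ?_
  rw [Finset.mem_Icc] at hl
  exact mul_t_sub_mem hN hI hq hl.1 hl.2

open Polynomial in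
lemma mul_aeval_prod_eq_zero (lam : ℕ → k) (c : ℕ) (J : Finset ℕ) (hJ : J.sum id < c)
    (q : MonoidAlgebra k (Equiv.Perm (Fin n))) (hq : q ∈ F n k J) :
    q * aeval (∑ l ∈ Finset.Icc 1 n, lam l • t n k l)
      (∏ I ∈ ((Finset.Icc 1 (n - 1)).powerset.filter Lacunar).filter (fun I => I.sum id < c),
        (X - C (∑ l ∈ Finset.Icc 1 n, lam l * (mIdx n I l : k)))) = 0 := by
  induction c generalizing J q with
  | zero => omega
  | succ c ih =>
  set T := ∑ l ∈ Finset.Icc 1 n, lam l • t n k l with hT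
  set L := (Finset.Icc 1 (n - 1)).powerset.filter Lacunar with hL
  set f : Finset ℕ → k[X] := fun I => X - C (∑ l ∈ Finset.Icc 1 n, lam l * (mIdx n I l : k))
    with hf
  have hsub : L.filter (fun I => I.sum id < c) ⊆ L.filter (fun I => I.sum id < c + 1) :=
    fun I hI => by
      simp only [Finset.mem_filter] at hI ⊢
      exact ⟨hI.1, by omega⟩
  have hlift : ∀ K : Finset ℕ, K.sum id < c → ∀ x ∈ F n k K,
      x * aeval T (∏ I ∈ L.filter (fun I => I.sum id < c + 1), f I) = 0 := by
    intro K hK x hx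
    rw [← Finset.prod_sdiff hsub, mul_comm, map_mul, ← mul_assoc, ih K hK x hx, zero_mul]
  rcases (Nat.lt_succ_iff.1 hJ).lt_or_eq with hlt | heq
  · exact hlift J hlt q hq
  wlog h0 : 0 ∉ J generalizing J
  · have hs : (J.erase 0).sum id = J.sum id := Finset.sum_erase _ rfl
    refine this (J.erase 0) (hs ▸ hJ) (F_mono (fun i hi => ?_) hq) (hs.trans heq) (by simp)
    simp only [mem_nonShadow, Finset.mem_erase] at hi ⊢
    refine ⟨hi.1, fun h => hi.2.1 ⟨by omega, h⟩, fun h => hi.2.2 ⟨by omega, h⟩⟩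
  by_cases hred : ∃ j ∈ J, n ≤ j ∨ j + 1 ∈ J
  · obtain ⟨j, hj, hjn⟩ := hred
    have hj1 : 1 ≤ j := Nat.one_le_iff_ne_zero.2 fun h => h0 (h ▸ hj)
    exact hlift (lowerAt J j) (heq ▸ sum_lowerAt_lt hj hj1) q (F_le_F_lowerAt hj1 hjn hq)
  · push Not at hred
    have hJL : J ∈ L.filter (fun I => I.sum id < c + 1) := by
      simp only [hL, Finset.mem_filter, Finset.mem_powerset]
      refine ⟨⟨fun j hj => ?_, fun j hj => (hred j hj).2⟩, hJ⟩
      have hj1 : j ≠ 0 := fun h => h0 (h ▸ hj)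
      have := (hred j hj).1
      rw [Finset.mem_Icc]
      omega
    have hdvd : L.filter (fun I => I.sum id < c) ⊆
        (L.filter (fun I => I.sum id < c + 1)).erase J := fun I hI => by
      refine Finset.mem_erase.2 ⟨?_, hsub hI⟩
      rintro rfl
      have := (Finset.mem_filter.1 hI).2
      omega
    have hmem := mul_sum_smul_t_sub_mem
      (N := LinearMap.ker (LinearMap.mulRight k
        (aeval T (∏ I ∈ L.filter (fun I => I.sum id < c), f I))))
      (fun K hK x hx => by simpa using ih K (heq ▸ hK) x hx)
      (fun i hi => (hred i hi).1.le) hq lam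
    rw [LinearMap.mem_ker, LinearMap.mulRight_apply] at hmem
    have hfJ : aeval T (f J) = T - algebraMap k (MonoidAlgebra k (Equiv.Perm (Fin n)))
        (∑ l ∈ Finset.Icc 1 n, lam l * (mIdx n J l : k)) := by
      rw [hf, map_sub, aeval_X, aeval_C]
    rw [← Finset.mul_prod_erase _ _ hJL, ← Finset.prod_sdiff hdvd,
      mul_comm (∏ I ∈ _ \ _, f I), map_mul, map_mul, hfJ, ← mul_assoc, ← mul_assoc, hmem,
      zero_mul]

end Invariants

/-- Theorem `thm.eigen.annih-pol`. With
`t = λ_1 t_1 + λ_2 t_2 + ⋯ + λ_n t_n`, the product over all lacunar subsets `I` of `[n-1]`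
of the (pairwise commuting) factors `t − (λ_1 m_{I,1} + ⋯ + λ_n m_{I,n})·1` is `0` in
`k[S_n]`. -/
theorem annihilating_polynomial (n : ℕ) (k : Type*) [CommRing k] (lam : ℕ → k) :
    Finset.noncommProd ((Finset.Icc 1 (n - 1)).powerset.filter Lacunar)
      (fun I => (∑ l ∈ Finset.Icc 1 n, lam l • t n k l) -
        algebraMap k (MonoidAlgebra k (Equiv.Perm (Fin n)))
          (∑ l ∈ Finset.Icc 1 n, lam l * (mIdx n I l : k)))
      (fun I _ J _ _ =>
        ((Commute.refl (∑ l ∈ Finset.Icc 1 n, lam l • t n k l)).sub_right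
            (Algebra.commute_algebraMap_right _ _)).sub_left
          ((Algebra.commute_algebraMap_left _ _).sub_right
            (Algebra.commute_algebraMap_left _ _))) = 0 := by
  set T := ∑ l ∈ Finset.Icc 1 n, lam l • t n k l with hT
  set L := (Finset.Icc 1 (n - 1)).powerset.filter Lacunar with hL
  set f : Finset ℕ → Polynomial k := fun I =>
    Polynomial.X - Polynomial.C (∑ l ∈ Finset.Icc 1 n, lam l * (mIdx n I l : k)) with hf
  have hmap := Finset.map_noncommProd L f (fun _ _ _ _ _ => Commute.all _ _) (Polynomial.aeval T)
  rw [Finset.noncommProd_eq_prod] at hmap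
  have hone : (1 : MonoidAlgebra k (Equiv.Perm (Fin n))) ∈ F n k (Finset.Icc 1 n) := fun i hi => by
    have hi' := mem_nonShadow.1 hi
    exact absurd (Finset.mem_Icc.2 ⟨hi'.1.1, hi'.1.2.le⟩) hi'.2.1
  have hzero : Polynomial.aeval T (∏ I ∈ L, f I) = 0 := by
    have hkill := mul_aeval_prod_eq_zero lam ((Finset.Icc 1 n).sum id + 1) (Finset.Icc 1 n)
      (Nat.lt_succ_self _) 1 hone
    rw [one_mul] at hkill
    rw [← Finset.prod_sdiff (Finset.filter_subset
      (fun I => I.sum id < (Finset.Icc 1 n).sum id + 1) L), map_mul, hkill, mul_zero]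
  rw [← hzero, hmap]
  refine Finset.noncommProd_congr rfl (fun I _ => ?_) _
  rw [hf, map_sub, Polynomial.aeval_X, Polynomial.aeval_C]

end OneSidedCycleShuffles
end
end

section
/- For every integer n ≥ 2, one has ∑_{i=2}^{n} n/(i·(H_n − H_{i−1})) ≤ n·log n + n·log(log n) + n·log 2 + 1, where log denotes the natural logarithm. -/
noncomputable section

namespace OneSidedCycleShuffles

/-- The `m`-th harmonic number `H_m = ∑_{k=1}^m 1/k` (so `H_0 = 0`). -/
def H (m : ℕ) : ℝ := ∑ j ∈ Finset.Icc 1 m, (1 : ℝ) / j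

lemma H_succ (m : ℕ) : H (m + 1) = H m + 1 / ((m : ℝ) + 1) := by
  unfold H
  rw [Finset.sum_Icc_succ_top (by omega)]
  push_cast
  rfl

lemma H_zero : H 0 = 0 := by simp [H]

lemma H_one : H 1 = 1 := by simp [H]

lemma strictMono_H : StrictMono H :=
  strictMono_nat_of_lt_succ fun m ↦ by
    rw [H_succ]
    exact lt_add_of_pos_right _ (by positivity)

lemma H_sub_H_le (j k : ℕ) : H (j + 1 + k) - H j ≤ ((k : ℝ) + 1) / (j + 1) := by
  induction k with
  | zero => simp [H_succ]
  | succ k ih =>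
    have h : (1 : ℝ) / (((j + 1 + k : ℕ) : ℝ) + 1) ≤ 1 / (j + 1) := by
      apply one_div_le_one_div_of_le (by positivity)
      push_cast
      linarith [(Nat.cast_nonneg k : (0 : ℝ) ≤ k)]
    rw [← add_assoc, H_succ]
    push_cast at h ⊢
    rw [add_div ((k : ℝ) + 1)]
    linarith

lemma H_le_log_two_mul_add_one (m : ℕ) : H m ≤ Real.log (2 * m + 1) := by
  induction m with
  | zero => simp [H_zero]
  | succ m ih =>
    have h := Real.le_log_one_add_of_nonneg (x := 2 / (2 * (m : ℝ) + 1)) (by positivity)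
    have e : 2 * (2 / (2 * (m : ℝ) + 1)) / (2 / (2 * (m : ℝ) + 1) + 2) = 1 / ((m : ℝ) + 1) := by
      field_simp
      ring
    have e' : 2 * ((m : ℝ) + 1) + 1 = (2 * (m : ℝ) + 1) * (1 + 2 / (2 * (m : ℝ) + 1)) := by
      field_simp
      ring
    rw [e] at h
    push_cast
    rw [H_succ, e', Real.log_mul (by positivity) (by positivity)]
    linarith

lemma H_le_log_add_log_two {m : ℕ} (hm : 1 ≤ m) :
    H m ≤ Real.log m + Real.log 2 + 1 / ((m : ℝ) + 1) := by
  have hm' : (1 : ℝ) ≤ m := by exact_mod_cast hm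
  have h := Real.log_le_sub_one_of_pos (x := 1 + 1 / (2 * (m : ℝ))) (by positivity)
  have e : 2 * (m : ℝ) + 1 = m * 2 * (1 + 1 / (2 * (m : ℝ))) := by
    field_simp
  have h' : 1 / (2 * (m : ℝ)) ≤ 1 / ((m : ℝ) + 1) :=
    one_div_le_one_div_of_le (by positivity) (by linarith)
  have hH := H_le_log_two_mul_add_one m
  rw [e, Real.log_mul (by positivity) (by positivity),
    Real.log_mul (by positivity) (by positivity)] at hH
  linarith

lemma H_le_one_add_log (m : ℕ) : H m ≤ 1 + Real.log m := by
  have h := harmonic_le_one_add_log m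
  rw [harmonic_eq_sum_Icc] at h
  push_cast at h
  simpa [H] using h

/-- The function `x ↦ -log (1 - x) - x` is increasing on `[0, 1)`. -/
lemma neg_log_one_sub_sub_le {x y : ℝ} (hy : 0 ≤ y) (hxy : y ≤ x) (hx : x < 1) :
    -Real.log (1 - y) - y ≤ -Real.log (1 - x) - x := by
  have hy1 : 0 < 1 - y := by linarith
  have hx1 : 0 < 1 - x := by linarith
  have h := Real.log_le_sub_one_of_pos (div_pos hx1 hy1)
  rw [Real.log_div hx1.ne' hy1.ne'] at h
  have h' : (1 - x) / (1 - y) - 1 ≤ y - x := by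
    rw [sub_le_iff_le_add, div_le_iff₀ hy1]
    nlinarith
  linarith

/-- Partial sums of the waiting time, from the last summand downwards. -/
lemma sum_one_div_mul_H_sub_H_le (k j : ℕ) :
    ∑ i ∈ Finset.Icc (j + 1) (j + 1 + k), 1 / ((i : ℝ) * (H (j + 1 + k) - H (i - 1))) ≤
      Real.log ((j + 1 + k : ℕ) : ℝ) + Real.log (H (j + 1 + k) - H j) + H (k + 1)
        - Real.log ((k : ℝ) + 1) := by
  induction k generalizing j with
  | zero =>
    have hj : (j : ℝ) + 1 ≠ 0 := by positivity
    simp [H_succ, H_zero, mul_inv_cancel₀ hj]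
  | succ k ih =>
    have ih := ih (j + 1)
    have hbound := H_sub_H_le j (k + 1)
    have hlt : H (j + 1) < H (j + 1 + (k + 1)) := strictMono_H (by omega)
    rw [show j + 1 + 1 + k = j + 1 + (k + 1) by ring] at ih
    rw [← Finset.insert_Icc_add_one_left_eq_Icc (by omega : j + 1 ≤ j + 1 + (k + 1)),
      Finset.sum_insert (by simp), H_succ (k + 1)]
    set N := j + 1 + (k + 1)
    have hstep := H_succ j
    simp only [Nat.add_sub_cancel]
    push_cast at hbound ⊢
    have hT' : 0 < H N - H (j + 1) := by linarith
    have hT : 0 < H N - H j := by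
      have : (0 : ℝ) < 1 / ((j : ℝ) + 1) := by positivity
      linarith
    have hx : 1 - 1 / (((j : ℝ) + 1) * (H N - H j)) = (H N - H (j + 1)) / (H N - H j) := by
      rw [hstep]
      field_simp
      ring
    have hy : 1 - 1 / ((k : ℝ) + 1 + 1) = ((k : ℝ) + 1) / ((k : ℝ) + 1 + 1) := by
      field_simp
      ring
    have hyx : 1 / ((k : ℝ) + 1 + 1) ≤ 1 / (((j : ℝ) + 1) * (H N - H j)) := by
      apply one_div_le_one_div_of_le (by positivity)
      rwa [le_div_iff₀' (by positivity)] at hbound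
    have hx1 : 1 / (((j : ℝ) + 1) * (H N - H j)) < 1 := by
      have : 0 < (H N - H (j + 1)) / (H N - H j) := div_pos hT' hT
      linarith
    have h := neg_log_one_sub_sub_le (by positivity) hyx hx1
    rw [hx, hy, Real.log_div hT'.ne' hT.ne',
      Real.log_div (by positivity) (by positivity)] at h
    linarith

/-- Theorem `thm.times.expect-r2b`, upper bound. For every integer
`n ≥ 2`:
`∑_{i=2}^{n} n/(i (H_n − H_{i−1})) ≤ n log n + n log (log n) + n log 2 + 1`,
where `log` is the natural logarithm. -/
theorem expected_waiting_time_bound (n : ℕ) (hn : 2 ≤ n) :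
    ∑ i ∈ Finset.Icc 2 n, (n : ℝ) / (i * (H n - H (i - 1))) ≤
      n * Real.log n + n * Real.log (Real.log n) + n * Real.log 2 + 1 := by
  have hn0 : (0 : ℝ) < n := by positivity
  obtain ⟨k, rfl⟩ : ∃ k, n = 1 + 1 + k := ⟨n - 2, by omega⟩
  have hsum := sum_one_div_mul_H_sub_H_le k 1
  have hH := H_le_log_add_log_two (Nat.le_add_left 1 k)
  have hpos : 0 < H (1 + 1 + k) - H 1 := sub_pos.2 (strictMono_H (by omega))
  have hlog : Real.log (H (1 + 1 + k) - H 1) ≤ Real.log (Real.log ((1 + 1 + k : ℕ) : ℝ)) :=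
    Real.log_le_log hpos (by linarith [H_le_one_add_log (1 + 1 + k), H_one])
  have hk : ((k + 1 : ℕ) : ℝ) + 1 = ((1 + 1 + k : ℕ) : ℝ) := by push_cast; ring
  rw [hk, Nat.cast_add_one] at hH
  set N := 1 + 1 + k
  calc ∑ i ∈ Finset.Icc 2 N, (N : ℝ) / (i * (H N - H (i - 1)))
      = N * ∑ i ∈ Finset.Icc (1 + 1) N, 1 / ((i : ℝ) * (H N - H (i - 1))) := by
        simp [Finset.mul_sum, div_eq_mul_inv]
    _ ≤ N * (Real.log N + Real.log (Real.log N) + Real.log 2 + 1 / N) := by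
        gcongr
        linarith
    _ = _ := by
        field_simp

end OneSidedCycleShuffles
end
end
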